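/- Let n ≥ 12 be an integer divisible by 6. Then: (i) for every integer m ≥ 1 and every nonzero homogeneous polynomial F ∈ ℂ[x,y,z] that vanishes to order at least m at every point of ℬ_n, one has 3·deg(F) ≥ m·n; and (ii) the product ℓ_0·ℓ_1·⋯·ℓ_{n−1} of the defining linear forms of the configuration lines is a nonzero homogeneous polynomial of degree n that vanishes to order at least 3 at every point of ℬ_n. Consequently the Waldschmidt constant of the defining ideal of ℬ_n, i.e. the infimum over m ≥ 1 of (minimal degree of a nonzero homogeneous form vanishing to order at least m at all points of ℬ_n)/m, equals n/3. -/

import Mathlib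

open Complex

/-- `P n j = exp(2πij/n)`. -/
noncomputable def Ppt (n j : ℕ) : ℂ := Complex.exp (2 * Real.pi * Complex.I * j / n)

/-- `Q n j = -exp(-4πij/n)`. -/
noncomputable def Qpt (n j : ℕ) : ℂ := -Complex.exp (-(4 * Real.pi * Complex.I * j) / n)

open scoped Classical in
/-- The `j`-th line of the Böröczky configuration: the line through `P n j` and
`Q n j` if they are distinct, and the tangent line to the unit circle at `P n j`
otherwise (identifying ℝ² with ℂ). -/
noncomputable def Bline (n j : ℕ) : Set ℂ :=
  if Ppt n j = Qpt n j then
    {z : ℂ | (z * (starRingEnd ℂ) (Ppt n j)).re = 1}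
  else
    {z : ℂ | ((z - Ppt n j) * (starRingEnd ℂ) (Qpt n j - Ppt n j)).im = 0}

/-- The set of triple points of the Böröczky configuration: points lying on at
least three of the lines `L_0, …, L_{n-1}`. -/
def TriplePts (n : ℕ) : Set ℂ :=
  {z : ℂ | 3 ≤ ({j : ℕ | j < n ∧ z ∈ Bline n j} : Set ℕ).ncard}

open MvPolynomial

/-- The point of ℂ³ corresponding to a planar point `p` (viewed as the
projective point `[Re p : Im p : 1]`). -/
noncomputable def projPt (p : ℂ) : Fin 3 → ℂ := ![(p.re : ℂ), (p.im : ℂ), 1]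

/-- `F` vanishes to order at least `m` at the planar point `p`: every partial
derivative of `F` of total order `< m` vanishes at `(Re p, Im p, 1)`. -/
def VanishesToOrder (F : MvPolynomial (Fin 3) ℂ) (m : ℕ) (p : ℂ) : Prop :=
  ∀ d : Fin 3 → ℕ, d 0 + d 1 + d 2 < m →
    eval (projPt p)
      ((fun G => pderiv (0 : Fin 3) G)^[d 0]
        ((fun G => pderiv (1 : Fin 3) G)^[d 1]
          ((fun G => pderiv (2 : Fin 3) G)^[d 2] F))) = 0

open scoped Classical in
/-- The defining linear form of the `j`-th configuration line: the determinant
of the matrix with rows `(x,y,z)`, `(Re P_j, Im P_j, 1)`, `(Re Q_j, Im Q_j, 1)`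
if `P_j ≠ Q_j`, and `(Re P_j)·x + (Im P_j)·y - z` if `P_j = Q_j`. -/
noncomputable def ell (n j : ℕ) : MvPolynomial (Fin 3) ℂ :=
  if Ppt n j = Qpt n j then
    C (((Ppt n j).re : ℂ)) * X 0 + C (((Ppt n j).im : ℂ)) * X 1 - X 2
  else
    C ((((Ppt n j).im - (Qpt n j).im : ℝ) : ℂ)) * X 0 -
      C ((((Ppt n j).re - (Qpt n j).re : ℝ) : ℂ)) * X 1 +
      C ((((Ppt n j).re * (Qpt n j).im - (Ppt n j).im * (Qpt n j).re : ℝ) : ℂ)) * X 2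

namespace Boroczky

section Multiplicity

variable {σ K : Type*} [Field K]

lemma pderiv_comm (i j : σ) (F : MvPolynomial σ K) :
    pderiv i (pderiv j F) = pderiv j (pderiv i F) := by
  classical
  have h : ⁅(pderiv i : Derivation K (MvPolynomial σ K) (MvPolynomial σ K)),
      (pderiv j : Derivation K (MvPolynomial σ K) (MvPolynomial σ K))⁆ = 0 := by
    refine MvPolynomial.derivation_ext fun k => ?_
    simp only [Derivation.commutator_apply, pderiv_X, Pi.single_apply]
    split_ifs <;> simp
  have := congrArg (fun D => D F) h
  simpa [Derivation.commutator_apply, sub_eq_zero] using this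

/-- Vanishing to order at least `m` at `p`, by recursion on the order. -/
def VanishesAt (p : σ → K) : ℕ → MvPolynomial σ K → Prop
  | 0, _ => True
  | m + 1, F => eval p F = 0 ∧ ∀ i, VanishesAt p m (pderiv i F)

namespace VanishesAt

variable {p : σ → K} {m k : ℕ} {F G : MvPolynomial σ K}

lemma of_succ (h : VanishesAt p (m + 1) F) : VanishesAt p m F := by
  induction m generalizing F with
  | zero => trivial
  | succ m ih => exact ⟨h.1, fun i => ih (h.2 i)⟩

lemma mono (hk : k ≤ m) (h : VanishesAt p m F) : VanishesAt p k F := by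
  induction hk with
  | refl => exact h
  | step _ ih => exact ih h.of_succ

lemma add (hF : VanishesAt p m F) (hG : VanishesAt p m G) : VanishesAt p m (F + G) := by
  induction m generalizing F G with
  | zero => trivial
  | succ m ih =>
    refine ⟨by simp [hF.1, hG.1], fun i => ?_⟩
    rw [map_add]
    exact ih (hF.2 i) (hG.2 i)

lemma mul_left (hF : VanishesAt p m F) (G : MvPolynomial σ K) : VanishesAt p m (G * F) := by
  induction m generalizing F G with
  | zero => trivial
  | succ m ih =>
    refine ⟨by simp [hF.1], fun i => ?_⟩
    rw [pderiv_mul]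
    exact (ih hF.of_succ _).add (ih (hF.2 i) _)

lemma mul_of_eval_eq_zero (hG : eval p G = 0) (hF : VanishesAt p m F) :
    VanishesAt p (m + 1) (G * F) := by
  induction m generalizing F with
  | zero => exact ⟨by simp [hG], fun _ => trivial⟩
  | succ m ih =>
    refine ⟨by simp [hG], fun i => ?_⟩
    rw [pderiv_mul]
    exact (hF.mul_left _).add (ih (hF.2 i))

lemma iterate_pderiv (i : σ) (h : VanishesAt p (m + k) F) :
    VanishesAt p m ((pderiv i)^[k] F) := by
  induction k generalizing F with
  | zero => exact h
  | succ k ih => exact ih (h.2 i)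

end VanishesAt

/-- The Taylor expansion of `F` at `p` in a generic direction: `F (p + s • x)` as a polynomial
in `s` whose coefficients are polynomials in the direction `x`. -/
noncomputable def taylorAt (p : σ → K) :
    MvPolynomial σ K →ₐ[K] Polynomial (MvPolynomial σ K) :=
  aeval fun i => Polynomial.C (C (p i)) + Polynomial.X * Polynomial.C (X i)

lemma taylorAt_X (p : σ → K) (i : σ) :
    taylorAt p (X i) = Polynomial.C (C (p i)) + Polynomial.X * Polynomial.C (X i) :=
  aeval_X _ i

lemma coeff_zero_taylorAt (p : σ → K) (F : MvPolynomial σ K) :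
    (taylorAt p F).coeff 0 = C (eval p F) := by
  induction F using MvPolynomial.induction_on with
  | C a => simp
  | add F G hF hG => simp [hF, hG]
  | mul_X F i hF => simp [hF, Polynomial.mul_coeff_zero, taylorAt_X]

lemma derivative_taylorAt [Fintype σ] (p : σ → K) (F : MvPolynomial σ K) :
    Polynomial.derivative (taylorAt p F) =
      ∑ i, Polynomial.C (X i) * taylorAt p (pderiv i F) := by
  classical
  induction F using MvPolynomial.induction_on with
  | C a => simp
  | add F G hF hG => simp [hF, hG, mul_add, Finset.sum_add_distrib]
  | mul_X F j hF =>
    have hX : Polynomial.derivative (taylorAt p (X j)) = Polynomial.C (X j) := by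
      simp [taylorAt_X]
    have hi (i : σ) : Polynomial.C (X i) * taylorAt p (pderiv i (F * X j)) =
        Polynomial.C (X i) * taylorAt p (pderiv i F) * taylorAt p (X j) +
          if i = j then taylorAt p F * Polynomial.C (X j) else 0 := by
      rw [pderiv_mul, pderiv_X, Pi.single_apply, map_add, map_mul, map_mul, mul_add, mul_assoc]
      obtain rfl | hij := eq_or_ne i j
      · simp [mul_comm]
      · simp [hij, hij.symm]
    rw [map_mul, Polynomial.derivative_mul, hF, hX, Finset.sum_congr rfl fun i _ => hi i,
      Finset.sum_add_distrib, Finset.sum_mul, Finset.sum_ite_eq' Finset.univ j]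
    simp

lemma VanishesAt.X_pow_dvd_taylorAt [Fintype σ] [CharZero K] {p : σ → K} {m : ℕ}
    {F : MvPolynomial σ K} (h : VanishesAt p m F) :
    (Polynomial.X : Polynomial (MvPolynomial σ K)) ^ m ∣ taylorAt p F := by
  induction m generalizing F with
  | zero => simp
  | succ m ih =>
    have hd : (Polynomial.X : Polynomial (MvPolynomial σ K)) ^ m ∣
        Polynomial.derivative (taylorAt p F) := by
      rw [derivative_taylorAt]
      exact Finset.dvd_sum fun i _ => (ih (h.2 i)).mul_left _
    rw [Polynomial.X_pow_dvd_iff] at hd ⊢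
    rintro (_ | d) hdm
    · rw [coeff_zero_taylorAt, h.1, map_zero]
    · have := hd d (by omega)
      rw [Polynomial.coeff_derivative] at this
      exact (mul_eq_zero.1 this).resolve_right (by exact_mod_cast d.succ_ne_zero)

lemma exists_isHomogeneous_of_eq_mul {F A G : MvPolynomial σ K} {e k : ℕ}
    (hF : F.IsHomogeneous e) (hF0 : F ≠ 0) (hA : A.IsHomogeneous k) (h : F = A * G) :
    k ≤ e ∧ ∃ H : MvPolynomial σ K, H.IsHomogeneous (e - k) ∧ F = A * H := by
  have key : F = ∑ i ∈ Finset.range (G.totalDegree + 1),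
      if e = k + i then A * homogeneousComponent i G else 0 := by
    conv_lhs => rw [← homogeneousComponent_eq_self hF, h, ← sum_homogeneousComponent G,
      Finset.mul_sum, map_sum]
    refine Finset.sum_congr rfl fun i _ => ?_
    exact homogeneousComponent_of_mem (hA.mul (homogeneousComponent_isHomogeneous i G))
  have hke : k ≤ e := by
    by_contra hlt
    refine hF0 (key.trans (Finset.sum_eq_zero fun i _ => if_neg (by omega)))
  refine ⟨hke, ∑ i ∈ Finset.range (G.totalDegree + 1),
    if e = k + i then homogeneousComponent i G else 0, ?_, ?_⟩
  · refine IsHomogeneous.sum _ _ _ fun i _ => ?_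
    split_ifs with hi
    · obtain rfl : i = e - k := by omega
      exact homogeneousComponent_isHomogeneous _ G
    · exact isHomogeneous_zero _ _ _
  · rw [Finset.mul_sum]
    exact key.trans (Finset.sum_congr rfl fun i _ => by split_ifs <;> simp)

lemma eval_smul_of_isHomogeneous {F : MvPolynomial σ K} {e : ℕ} (hF : F.IsHomogeneous e)
    (c : K) (v : σ → K) : eval (c • v) F = c ^ e * eval v F := by
  rw [eval_eq, eval_eq, Finset.mul_sum]
  refine Finset.sum_congr rfl fun d hd => ?_
  rw [hF.degree_eq_sum_deg_support hd, ← Finset.prod_pow_eq_pow_sum]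
  simp only [Pi.smul_apply, smul_eq_mul, mul_pow, Finset.prod_mul_distrib]
  ring

end Multiplicity

lemma vanishesToOrder_iff {F : MvPolynomial (Fin 3) ℂ} {m : ℕ} {z : ℂ} :
    VanishesToOrder F m z ↔ VanishesAt (projPt z) m F := by
  constructor
  · intro h
    induction m generalizing F with
    | zero => trivial
    | succ m ih =>
      refine ⟨by simpa using h 0 (by simp), fun i => ih fun d hd => ?_⟩
      have comm (i j : Fin 3) : Function.Commute (pderiv i : MvPolynomial (Fin 3) ℂ → _)
        (pderiv j) := pderiv_comm i j
      have := h (d + Pi.single i 1) (by fin_cases i <;> simp <;> omega)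
      fin_cases i
      · simpa [Function.iterate_succ_apply, ((comm 0 1).iterate_right (d 1)).eq,
          ((comm 0 2).iterate_right (d 2)).eq] using this
      · simpa [Function.iterate_succ_apply, ((comm 1 2).iterate_right (d 2)).eq] using this
      · simpa [Function.iterate_succ_apply] using this
  · intro h d hd
    have h1 : VanishesAt (projPt z) (1 + d 0 + d 1 + d 2) F := h.mono (by omega)
    exact (((h1.iterate_pderiv 2).iterate_pderiv 1).iterate_pderiv 0).1

section Line

variable {ζ ω : ℂ}

/-- The linear form vanishing at `[x : y : 1]` exactly when `ζ` is a root of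
`T ^ 3 - z * T ^ 2 + conj z * T - 1`, where `z = x + i y`. -/
noncomputable def lineForm (ζ : ℂ) : MvPolynomial (Fin 3) ℂ :=
  C (ζ - ζ ^ 2) * X 0 - C (I * (ζ + ζ ^ 2)) * X 1 + C (ζ ^ 3 - 1) * X 2

lemma eval_lineForm (ζ : ℂ) (v : Fin 3 → ℂ) : eval v (lineForm ζ) =
    (ζ - ζ ^ 2) * v 0 - I * (ζ + ζ ^ 2) * v 1 + (ζ ^ 3 - 1) * v 2 := by
  simp [lineForm]

lemma eval_projPt_lineForm (ζ z : ℂ) : eval (projPt z) (lineForm ζ) =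
    ζ ^ 3 - z * ζ ^ 2 + starRingEnd ℂ z * ζ - 1 := by
  have hz : starRingEnd ℂ z = z.re - I * z.im := by
    apply Complex.ext <;> simp
  simp [hz, eval_lineForm, projPt]
  linear_combination -ζ ^ 2 * Complex.re_add_im z

lemma isHomogeneous_lineForm (ζ : ℂ) : (lineForm ζ).IsHomogeneous 1 :=
  ((isHomogeneous_C_mul_X _ _).sub (isHomogeneous_C_mul_X _ _)).add (isHomogeneous_C_mul_X _ _)

/-- The coordinates of a projection of `ℂ³` onto the plane where `lineForm ζ` vanishes. -/
noncomputable def lineRetract (ζ : ℂ) : Fin 3 → MvPolynomial (Fin 3) ℂ :=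
  ![X 0 - C (1 / (2 * ζ)) * lineForm ζ, X 1 - C (I / (2 * ζ)) * lineForm ζ, X 2]

lemma eval_aeval_lineRetract (v : Fin 3 → ℂ) (F : MvPolynomial (Fin 3) ℂ) :
    eval v (aeval (lineRetract ζ) F) = eval (fun i => eval v (lineRetract ζ i)) F := by
  rw [MvPolynomial.map_aeval]
  congr 1
  refine MvPolynomial.ringHom_ext (fun a => ?_) fun i => ?_ <;> simp

lemma eval_lineRetract_lineForm (hζ : ζ ≠ 0) (v : Fin 3 → ℂ) :
    eval (fun i => eval v (lineRetract ζ i)) (lineForm ζ) = 0 := by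
  rw [eval_lineForm]
  simp [lineRetract, eval_lineForm]
  field_simp
  linear_combination ((ζ - ζ ^ 3) * v 0 - ζ * (1 + ζ) ^ 2 * I * v 1 +
    (ζ ^ 4 + ζ ^ 3 - ζ - 1) * v 2) * I_sq

lemma aeval_lineRetract_lineForm (hζ : ζ ≠ 0) : aeval (lineRetract ζ) (lineForm ζ) = 0 :=
  MvPolynomial.funext fun v => by
    rw [eval_aeval_lineRetract, eval_lineRetract_lineForm hζ, map_zero]

lemma lineForm_dvd_iff (hζ : ζ ≠ 0) {F : MvPolynomial (Fin 3) ℂ} :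
    lineForm ζ ∣ F ↔ aeval (lineRetract ζ) F = 0 := by
  constructor
  · rintro ⟨G, rfl⟩
    rw [map_mul, aeval_lineRetract_lineForm hζ, zero_mul]
  · intro h
    let q := Ideal.Quotient.mkₐ ℂ (Ideal.span {lineForm ζ})
    have hq : q (lineForm ζ) = 0 :=
      Ideal.Quotient.eq_zero_iff_mem.2 (Ideal.mem_span_singleton_self _)
    have : q.comp (aeval (lineRetract ζ)) = q := by
      refine MvPolynomial.algHom_ext fun i => ?_
      fin_cases i <;> simp [lineRetract, hq]
    rw [← Ideal.mem_span_singleton, ← Ideal.Quotient.eq_zero_iff_mem]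
    change q F = 0
    rw [← this, AlgHom.comp_apply, h, map_zero]

/-- The point at infinity of the line `lineForm ζ = 0`. -/
noncomputable def lineDir (ζ : ℂ) : Fin 3 → ℂ := ![(1 + ζ) / 2, (1 - ζ) / (2 * I), 0]

lemma eval_lineDir_lineForm (ζ ω : ℂ) :
    eval (lineDir ζ) (lineForm ω) = ω * (ζ - ω) := by
  simp [eval_lineForm, lineDir]
  field_simp
  ring

lemma not_lineForm_dvd_lineForm (hω : ω ≠ 0) (h : ζ ≠ ω) : ¬ lineForm ζ ∣ lineForm ω := by
  rintro ⟨G, hG⟩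
  have := congrArg (eval (lineDir ζ)) hG
  rw [map_mul, eval_lineDir_lineForm, eval_lineDir_lineForm, sub_self, mul_zero, zero_mul] at this
  exact mul_ne_zero hω (sub_ne_zero.2 h) this

lemma lineForm_ne_zero (hζ : ζ ≠ 0) : lineForm ζ ≠ 0 := by
  intro h
  have := eval_lineDir_lineForm (2 * ζ) ζ
  rw [h, map_zero] at this
  refine hζ (mul_self_eq_zero.1 ?_)
  linear_combination -this

lemma prime_lineForm (hζ : ζ ≠ 0) : Prime (lineForm ζ) := by
  refine ⟨lineForm_ne_zero hζ, fun h => ?_, fun F G h => ?_⟩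
  · have := (lineForm_dvd_iff hζ).1 (h.dvd (a := 1))
    simp at this
  · simpa only [lineForm_dvd_iff hζ, map_mul, mul_eq_zero] using h

lemma prod_lineForm_dvd {S : Finset ℂ} (hS : ∀ ζ ∈ S, ζ ≠ 0) {F : MvPolynomial (Fin 3) ℂ}
    (h : ∀ ζ ∈ S, lineForm ζ ∣ F) : ∏ ζ ∈ S, lineForm ζ ∣ F := by
  induction S using Finset.induction_on with
  | empty => simp
  | insert ζ S hζS ih =>
    simp only [Finset.forall_mem_insert] at hS h
    obtain ⟨G, rfl⟩ := ih hS.2 h.2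
    have hp := prime_lineForm hS.1
    have : ¬ lineForm ζ ∣ ∏ ω ∈ S, lineForm ω := fun hdvd => by
      obtain ⟨ω, hω, hdvd⟩ := hp.exists_mem_finset_dvd hdvd
      exact not_lineForm_dvd_lineForm (hS.2 ω hω) (ne_of_mem_of_not_mem hω hζS).symm hdvd
    rw [Finset.prod_insert hζS, mul_comm]
    exact mul_dvd_mul_left _ ((hp.dvd_or_dvd h.1).resolve_left this)

/-- A parametrization of the line `lineForm ζ = 0` by the coordinate `z = x + i y`. -/
noncomputable def linePath (ζ : ℂ) : Fin 3 → Polynomial ℂ :=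
  ![Polynomial.C ((1 + ζ) / 2) * Polynomial.X + Polynomial.C ((ζ⁻¹ - ζ ^ 2) / 2),
    Polynomial.C ((1 - ζ) / (2 * I)) * Polynomial.X + Polynomial.C (-(ζ⁻¹ - ζ ^ 2) / (2 * I)), 1]

lemma natDegree_linePath_le (ζ : ℂ) (i : Fin 3) : (linePath ζ i).natDegree ≤ 1 := by
  fin_cases i
  · exact Polynomial.natDegree_linear_le
  · exact Polynomial.natDegree_linear_le
  · simp [linePath]

lemma eval_aeval_linePath (s : ℂ) (F : MvPolynomial (Fin 3) ℂ) :
    (aeval (linePath ζ) F).eval s = eval (fun i => (linePath ζ i).eval s) F := by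
  have h := MvPolynomial.map_aeval (linePath ζ) (Polynomial.evalRingHom s) F
  rw [← Polynomial.coe_evalRingHom, h]
  congr 1
  refine MvPolynomial.ringHom_ext (fun a => ?_) fun i => ?_ <;> simp

lemma eval_linePath (hζ : ζ ≠ 0) {v : Fin 3 → ℂ} (h2 : v 2 = 1)
    (hv : eval v (lineForm ζ) = 0) : (fun i => (linePath ζ i).eval (v 0 + I * v 1)) = v := by
  rw [eval_lineForm, h2] at hv
  funext i
  fin_cases i
  · simp [linePath]
    field_simp
    linear_combination -hv
  · simp [linePath]
    field_simp
    linear_combination hv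
  · simp [linePath, h2]

lemma lineForm_dvd_of_aeval_linePath (hζ : ζ ≠ 0) {F : MvPolynomial (Fin 3) ℂ} {e : ℕ}
    (hF : F.IsHomogeneous e) (h : aeval (linePath ζ) F = 0) : lineForm ζ ∣ F := by
  rw [lineForm_dvd_iff hζ]
  have : X 2 * aeval (lineRetract ζ) F = 0 := by
    refine MvPolynomial.funext fun v => ?_
    rw [map_mul, eval_X, map_zero, mul_eq_zero, or_iff_not_imp_left]
    intro hv
    rw [eval_aeval_lineRetract]
    set w : Fin 3 → ℂ := fun i => eval v (lineRetract ζ i) with hw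
    have hw2 : w 2 = v 2 := by simp [hw, lineRetract]
    have hwl : eval ((v 2)⁻¹ • w) (lineForm ζ) = 0 := by
      rw [eval_smul_of_isHomogeneous (isHomogeneous_lineForm ζ),
        eval_lineRetract_lineForm hζ, mul_zero]
    have hpath := eval_linePath hζ (by simp [hw2, hv]) hwl
    have h0 : eval ((v 2)⁻¹ • w) F = 0 := by
      rw [← hpath, ← eval_aeval_linePath, h, Polynomial.eval_zero]
    rw [eval_smul_of_isHomogeneous hF] at h0
    exact (mul_eq_zero.1 h0).resolve_left (pow_ne_zero _ (inv_ne_zero hv))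
  exact (mul_eq_zero.1 this).resolve_left (X_ne_zero _)

lemma X_sub_C_pow_dvd_aeval_linePath (hζ : ζ ≠ 0) {z : ℂ} {m : ℕ}
    (hz : eval (projPt z) (lineForm ζ) = 0) {F : MvPolynomial (Fin 3) ℂ}
    (h : (Polynomial.X : Polynomial (MvPolynomial (Fin 3) ℂ)) ^ m ∣ taylorAt (projPt z) F) :
    (Polynomial.X - Polynomial.C z) ^ m ∣ aeval (linePath ζ) F := by
  let ψ : Polynomial (MvPolynomial (Fin 3) ℂ) →+* Polynomial ℂ :=
    Polynomial.eval₂RingHom (Polynomial.C.comp (eval (lineDir ζ)))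
      (Polynomial.X - Polynomial.C z)
  have hψ : ψ.comp (taylorAt (projPt z)).toRingHom = (aeval (linePath ζ)).toRingHom := by
    have hpath := eval_linePath hζ (by simp [projPt]) hz
    have hz' : projPt z 0 + I * projPt z 1 = z := by
      simpa [projPt, mul_comm] using Complex.re_add_im z
    rw [hz'] at hpath
    refine MvPolynomial.ringHom_ext (fun a => ?_) fun i => ?_
    · simp [ψ]
    · simp only [ψ, RingHom.comp_apply, AlgHom.toRingHom_eq_coe, RingHom.coe_coe, taylorAt_X,
        aeval_X, ← congrFun hpath i]
      fin_cases i <;> simp [linePath, lineDir] <;> ring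
  have := map_dvd ψ h
  rw [map_pow] at this
  convert this using 1
  · simp [ψ]
  · exact (RingHom.congr_fun hψ F).symm

/-- Bézout's theorem for a line. -/
lemma lineForm_dvd_of_lt (hζ : ζ ≠ 0) {F : MvPolynomial (Fin 3) ℂ} {e m : ℕ}
    (hF : F.IsHomogeneous e) {T : Finset ℂ}
    (hT : ∀ z ∈ T, eval (projPt z) (lineForm ζ) = 0)
    (h : ∀ z ∈ T,
      (Polynomial.X : Polynomial (MvPolynomial (Fin 3) ℂ)) ^ m ∣ taylorAt (projPt z) F)
    (hlt : e < T.card * m) : lineForm ζ ∣ F := by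
  refine lineForm_dvd_of_aeval_linePath hζ hF ?_
  by_contra h0
  have hdvd : ∏ z ∈ T, (Polynomial.X - Polynomial.C z) ^ m ∣ aeval (linePath ζ) F := by
    refine Finset.prod_dvd_of_coprime (fun z _ w _ hzw => ?_) fun z hz =>
      X_sub_C_pow_dvd_aeval_linePath hζ (hT z hz) (h z hz)
    exact (Polynomial.isCoprime_X_sub_C_of_isUnit_sub (sub_ne_zero.2 hzw).isUnit).pow
  have h1 := Polynomial.natDegree_le_of_dvd hdvd h0
  have h2 := MvPolynomial.aeval_natDegree_le F hF.totalDegree_le _ (natDegree_linePath_le ζ)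
  rw [Polynomial.natDegree_prod_of_monic _ _
    fun z _ => (Polynomial.monic_X_sub_C z).pow m] at h1
  simp at h1
  omega

end Line

section LowerBound

lemma card_filter_lineForm_le (S : Finset ℂ) (z : ℂ) :
    (S.filter fun ζ => eval (projPt z) (lineForm ζ) = 0).card ≤ 3 := by
  let q : Polynomial ℂ := Polynomial.X ^ 3 - Polynomial.C z * Polynomial.X ^ 2 +
    Polynomial.C (starRingEnd ℂ z) * Polynomial.X - 1
  have hdeg : q.natDegree = 3 := by
    simp only [q]
    compute_degree!
  have hq : q ≠ 0 := fun h => by simp [h] at hdeg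
  calc _ ≤ q.roots.toFinset.card := by
        refine Finset.card_le_card fun ζ hζ => ?_
        rw [Multiset.mem_toFinset, Polynomial.mem_roots hq]
        have := (Finset.mem_filter.1 hζ).2
        rw [eval_projPt_lineForm] at this
        simpa [q] using this
    _ ≤ q.roots.card := Multiset.toFinset_card_le _
    _ ≤ 3 := hdeg ▸ q.card_roots'

lemma taylorAt_lineForm (p : Fin 3 → ℂ) (ζ : ℂ) : taylorAt p (lineForm ζ) =
    Polynomial.C (C (eval p (lineForm ζ))) + Polynomial.X * Polynomial.C (lineForm ζ) := by
  rw [eval_lineForm]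
  have hC (a : ℂ) : taylorAt p (C a) = Polynomial.C (C a) := by simp
  simp only [lineForm, map_add, map_sub, map_mul, taylorAt_X, hC]
  ring

lemma emultiplicity_taylorAt_lineForm_le {ζ : ℂ} (hζ : ζ ≠ 0) (p : Fin 3 → ℂ) :
    emultiplicity (Polynomial.X : Polynomial (MvPolynomial (Fin 3) ℂ)) (taylorAt p (lineForm ζ)) ≤
      if eval p (lineForm ζ) = 0 then 1 else 0 := by
  rw [taylorAt_lineForm]
  split_ifs with h
  · refine Order.le_of_lt_add_one (emultiplicity_lt_iff_not_dvd (k := 2) |>.2 fun hdvd => ?_)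
    have := Polynomial.X_pow_dvd_iff.1 hdvd 1 (by omega)
    exact lineForm_ne_zero hζ (by simpa [h] using this)
  · refine (emultiplicity_eq_zero.2 fun hdvd => h ?_).le
    have := Polynomial.X_dvd_iff.1 hdvd
    simpa using this

lemma X_pow_sub_dvd_taylorAt {S : Finset ℂ} (hS : ∀ ζ ∈ S, ζ ≠ 0) {G : MvPolynomial (Fin 3) ℂ}
    {m : ℕ} {z : ℂ} (h : (Polynomial.X : Polynomial (MvPolynomial (Fin 3) ℂ)) ^ m ∣
      taylorAt (projPt z) ((∏ ζ ∈ S, lineForm ζ) * G)) :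
    (Polynomial.X : Polynomial (MvPolynomial (Fin 3) ℂ)) ^ (m - 3) ∣ taylorAt (projPt z) G := by
  rw [pow_dvd_iff_le_emultiplicity] at h ⊢
  rw [map_mul, emultiplicity_mul Polynomial.prime_X, map_prod,
    Finset.emultiplicity_prod Polynomial.prime_X] at h
  have hle : ∑ ζ ∈ S, emultiplicity (Polynomial.X : Polynomial (MvPolynomial (Fin 3) ℂ))
      (taylorAt (projPt z) (lineForm ζ)) ≤ 3 := by
    refine (Finset.sum_le_sum fun ζ hζ =>
      emultiplicity_taylorAt_lineForm_le (hS ζ hζ) (projPt z)).trans ?_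
    rw [Finset.sum_boole]
    exact_mod_cast card_filter_lineForm_le S z
  have := h.trans (add_le_add_left hle _)
  generalize emultiplicity _ (taylorAt (projPt z) G) = a at this ⊢
  induction a using ENat.recTopCoe with
  | top => exact le_top
  | coe a =>
    have : m ≤ 3 + a := by exact_mod_cast this
    exact_mod_cast (by omega : m - 3 ≤ a)

lemma isHomogeneous_prod_lineForm (S : Finset ℂ) :
    (∏ ζ ∈ S, lineForm ζ).IsHomogeneous S.card := by
  simpa using IsHomogeneous.prod S lineForm (fun _ => 1) fun ζ _ => isHomogeneous_lineForm ζ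

/-- If each of the lines `lineForm ζ = 0`, `ζ ∈ S`, contains at least `|S| / 3` points of `P`,
then a form vanishing to order `m` on `P` has degree at least `m |S| / 3`. -/
theorem mul_card_le_three_mul_degree {S : Finset ℂ} (hS : ∀ ζ ∈ S, ζ ≠ 0) {P : Set ℂ}
    (hP : ∀ ζ ∈ S, ∃ T : Finset ℂ, ↑T ⊆ P ∧
      (∀ z ∈ T, eval (projPt z) (lineForm ζ) = 0) ∧ S.card ≤ 3 * T.card)
    {m e : ℕ} {F : MvPolynomial (Fin 3) ℂ} (hF0 : F ≠ 0) (hF : F.IsHomogeneous e)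
    (hm : ∀ z ∈ P, (Polynomial.X : Polynomial (MvPolynomial (Fin 3) ℂ)) ^ m ∣
      taylorAt (projPt z) F) : m * S.card ≤ 3 * e := by
  induction m using Nat.strong_induction_on generalizing F e with
  | _ m ih =>
    by_contra! hlt
    have hdvd : ∏ ζ ∈ S, lineForm ζ ∣ F := by
      refine prod_lineForm_dvd hS fun ζ hζ => ?_
      obtain ⟨T, hTP, hTl, hTc⟩ := hP ζ hζ
      refine lineForm_dvd_of_lt (hS ζ hζ) hF hTl (fun z hz => hm z (hTP hz)) ?_
      have := Nat.mul_le_mul_left m hTc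
      nlinarith
    obtain ⟨G, hG⟩ := hdvd
    obtain ⟨hle, H, hH, rfl⟩ :=
      exists_isHomogeneous_of_eq_mul hF hF0 (isHomogeneous_prod_lineForm S) hG
    have hm3 : 3 < m := by
      by_contra! h
      have := Nat.mul_le_mul_right S.card h
      omega
    have := ih (m - 3) (by omega) (right_ne_zero_of_mul hF0) hH
      fun z hz => X_pow_sub_dvd_taylorAt hS (hm z hz)
    obtain ⟨k, rfl⟩ := Nat.exists_eq_add_of_lt hm3
    have h3 : 3 + k + 1 - 3 = k + 1 := by omega
    rw [h3] at this
    have h4 : (3 + k + 1) * S.card = 3 * S.card + (k + 1) * S.card := by ring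
    omega

end LowerBound

section Configuration

lemma Ppt_eq_pow (n j : ℕ) : Ppt n j = exp (2 * Real.pi * I / n) ^ j := by
  rw [Ppt, ← Complex.exp_nat_mul]
  congr 1
  ring

lemma Ppt_ne_zero (n j : ℕ) : Ppt n j ≠ 0 := Complex.exp_ne_zero _

lemma Qpt_eq (n j : ℕ) : Qpt n j = -(Ppt n j ^ 2)⁻¹ := by
  rw [Qpt, Ppt, ← Complex.exp_nat_mul, ← Complex.exp_neg]
  congr 2
  push_cast
  ring

lemma conj_Ppt (n j : ℕ) : starRingEnd ℂ (Ppt n j) = (Ppt n j)⁻¹ := by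
  rw [Ppt, ← Complex.exp_conj, ← Complex.exp_neg]
  congr 1
  simp [neg_div, Complex.conj_ofNat]

lemma exists_Ppt_eq {n : ℕ} (hn : n ≠ 0) {ζ : ℂ} (h : ζ ^ n = 1) : ∃ j < n, Ppt n j = ζ := by
  have : NeZero n := ⟨hn⟩
  obtain ⟨j, hj, h⟩ := (Complex.isPrimitiveRoot_exp n hn).eq_pow_of_pow_eq_one h
  exact ⟨j, hj, (Ppt_eq_pow n j).trans h⟩

/-- The forms `ell n j` and `lineForm (Ppt n j)` are proportional. -/
lemma exists_ell_eq (n j : ℕ) : ∃ c : ℂ, c ≠ 0 ∧ ell n j = C c * lineForm (Ppt n j) := by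
  have h0 := Ppt_ne_zero n j
  have hc := conj_Ppt n j
  have hQ := Qpt_eq n j
  have hcQ : starRingEnd ℂ (Qpt n j) = -Ppt n j ^ 2 := by rw [hQ]; simp [hc]
  unfold ell
  generalize Ppt n j = ζ at *
  generalize Qpt n j = ω at *
  split_ifs with h
  · have h3 : ζ ^ 3 = -1 := by
      rw [← h] at hQ
      field_simp at hQ
      linear_combination hQ
    refine ⟨1 / 2, by norm_num, ?_⟩
    rw [Complex.re_eq_add_conj, Complex.im_eq_sub_conj, hc]
    have h1 : (ζ + ζ⁻¹) / 2 = 1 / 2 * (ζ - ζ ^ 2) := by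
      field_simp
      linear_combination h3
    have h2 : (ζ - ζ⁻¹) / (2 * I) = -(1 / 2 * (I * (ζ + ζ ^ 2))) := by
      field_simp
      linear_combination (-1) * h3 + (ζ ^ 2 + ζ ^ 3) * I_sq
    have h3' : (-1 : ℂ) = 1 / 2 * (ζ ^ 3 - 1) := by linear_combination -h3 / 2
    rw [h1, h2, lineForm]
    have : (X 2 : MvPolynomial (Fin 3) ℂ) = -(C (1 / 2 * (ζ ^ 3 - 1)) * X 2) := by
      rw [← h3']
      simp
    simp only [map_mul, map_neg] at this ⊢
    linear_combination -this
  · refine ⟨(ζ ^ 3 + 1) / (2 * I * ζ ^ 3), ?_, ?_⟩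
    · refine div_ne_zero (fun h3 => h ?_) (by simp [h0])
      rw [hQ]
      field_simp
      linear_combination h3
    · push_cast
      simp only [Complex.re_eq_add_conj, Complex.im_eq_sub_conj, hc, hcQ]
      rw [hQ]
      have h1 : (ζ - ζ⁻¹) / (2 * I) - (-(ζ ^ 2)⁻¹ - -ζ ^ 2) / (2 * I) =
        (ζ ^ 3 + 1) / (2 * I * ζ ^ 3) * (ζ - ζ ^ 2) := by
        field_simp
        ring
      have h2 : (ζ + ζ⁻¹) / 2 - (-(ζ ^ 2)⁻¹ + -ζ ^ 2) / 2 =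
        (ζ ^ 3 + 1) / (2 * I * ζ ^ 3) * (I * (ζ + ζ ^ 2)) := by
        field_simp
        ring
      have h3 : (ζ + ζ⁻¹) / 2 * ((-(ζ ^ 2)⁻¹ - -ζ ^ 2) / (2 * I)) -
        (ζ - ζ⁻¹) / (2 * I) * ((-(ζ ^ 2)⁻¹ + -ζ ^ 2) / 2) =
        (ζ ^ 3 + 1) / (2 * I * ζ ^ 3) * (ζ ^ 3 - 1) := by
        field_simp
        ring
      rw [h1, h2, h3, lineForm]
      simp only [map_mul]
      ring

lemma eval_ell_eq_zero_iff (n j : ℕ) (v : Fin 3 → ℂ) :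
    eval v (ell n j) = 0 ↔ eval v (lineForm (Ppt n j)) = 0 := by
  obtain ⟨c, hc, h⟩ := exists_ell_eq n j
  simp [h, hc]

lemma mem_Bline_iff (n j : ℕ) (z : ℂ) : z ∈ Bline n j ↔ eval (projPt z) (ell n j) = 0 := by
  unfold Bline ell
  split_ifs with h
  · rw [Set.mem_ofPred_eq, ← sub_eq_zero, ← Complex.ofReal_eq_zero]
    refine Eq.congr_left ?_
    simp [projPt]
    ring
  · rw [Set.mem_ofPred_eq, ← Complex.ofReal_eq_zero]
    refine Eq.congr_left ?_
    simp [projPt]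
    ring

lemma mem_Bline_iff_lineForm {n j : ℕ} {z : ℂ} :
    z ∈ Bline n j ↔ eval (projPt z) (lineForm (Ppt n j)) = 0 := by
  rw [mem_Bline_iff, eval_ell_eq_zero_iff]

end Configuration

section TriplePoints

lemma eval_projPt_lineForm_eq_zero_iff {ζ ω ξ : ℂ} (hζ : ‖ζ‖ = 1) (hω : ‖ω‖ = 1)
    (hξ : ‖ξ‖ = 1) (h : ζ * ω * ξ = 1) (t : ℂ) :
    eval (projPt (ζ + ω + ξ)) (lineForm t) = 0 ↔ t = ζ ∨ t = ω ∨ t = ξ := by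
  have key : eval (projPt (ζ + ω + ξ)) (lineForm t) = (t - ζ) * ((t - ω) * (t - ξ)) := by
    have h0 : ζ * ω * ξ ≠ 0 := by simp [h]
    simp only [mul_ne_zero_iff] at h0
    have e1 : ζ⁻¹ = ω * ξ := inv_eq_of_mul_eq_one_right (by linear_combination h)
    have e2 : ω⁻¹ = ζ * ξ := inv_eq_of_mul_eq_one_right (by linear_combination h)
    have e3 : ξ⁻¹ = ζ * ω := inv_eq_of_mul_eq_one_right (by linear_combination h)
    rw [eval_projPt_lineForm, map_add, map_add, ← Complex.inv_eq_conj hζ,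
      ← Complex.inv_eq_conj hω, ← Complex.inv_eq_conj hξ, e1, e2, e3]
    linear_combination h
  simp [key, sub_eq_zero]

lemma mem_triplePts {n : ℕ} (hn : n ≠ 0) {ζ ω ξ : ℂ} (hζ : ζ ^ n = 1) (hω : ω ^ n = 1)
    (hξ : ξ ^ n = 1) (h : ζ * ω * ξ = 1) (h1 : ζ ≠ ω) (h2 : ζ ≠ ξ) (h3 : ω ≠ ξ) :
    ζ + ω + ξ ∈ TriplePts n := by
  have iff := eval_projPt_lineForm_eq_zero_iff (Complex.norm_eq_one_of_pow_eq_one hζ hn)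
    (Complex.norm_eq_one_of_pow_eq_one hω hn) (Complex.norm_eq_one_of_pow_eq_one hξ hn) h
  obtain ⟨i, hi, rfl⟩ := exists_Ppt_eq hn hζ
  obtain ⟨j, hj, rfl⟩ := exists_Ppt_eq hn hω
  obtain ⟨k, hk, rfl⟩ := exists_Ppt_eq hn hξ
  have hfin (z : ℂ) : {j : ℕ | j < n ∧ z ∈ Bline n j}.Finite :=
    (Set.finite_lt_nat n).subset fun _ h => h.1
  refine (Set.two_lt_ncard_iff (hfin _)).2 ⟨i, j, k, ⟨hi, ?_⟩, ⟨hj, ?_⟩, ⟨hk, ?_⟩,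
    ne_of_apply_ne _ h1, ne_of_apply_ne _ h2, ne_of_apply_ne _ h3⟩ <;>
  simp [mem_Bline_iff_lineForm, iff]

lemma exists_triplePts_on_line {n : ℕ} (hn : 12 ≤ n) {ζ : ℂ} (hζ : ζ ^ n = 1) :
    ∃ T : Finset ℂ, ↑T ⊆ TriplePts n ∧
      (∀ z ∈ T, eval (projPt z) (lineForm ζ) = 0) ∧ n ≤ 3 * T.card := by
  classical
  have hn0 : n ≠ 0 := by omega
  have hζ0 : ζ ≠ 0 := by rintro rfl; simp [hn0] at hζ
  let R := Polynomial.nthRootsFinset n (1 : ℂ)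
  have hR {ω : ℂ} : ω ∈ R ↔ ω ^ n = 1 := Polynomial.mem_nthRootsFinset (by omega) 1
  have hRcard : R.card = n := (Complex.isPrimitiveRoot_exp n hn0).card_nthRootsFinset
  let E : Finset ℂ := {ζ, (ζ ^ 2)⁻¹} ∪ (Polynomial.nthRoots 2 ζ⁻¹).toFinset
  have hE : E.card ≤ 4 := by
    have h1 : ({ζ, (ζ ^ 2)⁻¹} : Finset ℂ).card ≤ 2 := Finset.card_le_two
    have h2 : (Polynomial.nthRoots 2 ζ⁻¹).toFinset.card ≤ 2 :=
      (Multiset.toFinset_card_le _).trans (Polynomial.card_nthRoots 2 _)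
    exact (Finset.card_union_le _ _).trans (add_le_add h1 h2)
  have hmem {ω : ℂ} (h : ω ∈ R \ E) : ω ^ n = 1 ∧ ((ζ * ω)⁻¹) ^ n = 1 ∧ ζ * ω * (ζ * ω)⁻¹ = 1 ∧
      ζ ≠ ω ∧ ζ ≠ (ζ * ω)⁻¹ ∧ ω ≠ (ζ * ω)⁻¹ := by
    simp only [Finset.mem_sdiff, hR, E, Finset.mem_union, Finset.mem_insert,
      Finset.mem_singleton, Multiset.mem_toFinset, Polynomial.mem_nthRoots two_pos, not_or] at h
    obtain ⟨hω, ⟨h1, h2⟩, h3⟩ := h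
    have hω0 : ω ≠ 0 := by rintro rfl; simp [hn0] at hω
    refine ⟨hω, by simp [mul_pow, hζ, hω], mul_inv_cancel₀ (mul_ne_zero hζ0 hω0), Ne.symm h1,
      fun h => h2 ?_, fun h => h3 ?_⟩
    · field_simp at h ⊢
      linear_combination h
    · field_simp at h ⊢
      linear_combination h
  have hroots {ω : ℂ} (h : ω ∈ R \ E) (t : ℂ) :
      eval (projPt (ζ + ω + (ζ * ω)⁻¹)) (lineForm t) = 0 ↔ t = ζ ∨ t = ω ∨ t = (ζ * ω)⁻¹ :=
    have hω := hmem h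
    eval_projPt_lineForm_eq_zero_iff (Complex.norm_eq_one_of_pow_eq_one hζ hn0)
      (Complex.norm_eq_one_of_pow_eq_one hω.1 hn0)
      (Complex.norm_eq_one_of_pow_eq_one hω.2.1 hn0) hω.2.2.1 t
  refine ⟨(R \ E).image fun ω => ζ + ω + (ζ * ω)⁻¹, ?_, ?_, ?_⟩
  · intro z hz
    obtain ⟨ω, hω, rfl⟩ := Finset.mem_image.1 hz
    obtain ⟨h1, h2, h3, h4, h5, h6⟩ := hmem hω
    exact mem_triplePts hn0 hζ h1 h2 h3 h4 h5 h6
  · intro z hz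
    obtain ⟨ω, hω, rfl⟩ := Finset.mem_image.1 hz
    exact (hroots hω ζ).2 (Or.inl rfl)
  · have hfib := Finset.card_le_mul_card_image (f := fun ω => ζ + ω + (ζ * ω)⁻¹) (R \ E) 2 ?_
    · have := Finset.le_card_sdiff E R
      omega
    · intro z hz
      obtain ⟨ω, hω, rfl⟩ := Finset.mem_image.1 hz
      refine (Finset.card_le_card (t := {ω, (ζ * ω)⁻¹}) fun ξ hξ => ?_).trans Finset.card_le_two
      obtain ⟨hξ, heq⟩ := Finset.mem_filter.1 hξ
      have h1 := (hroots hω ξ).1 (heq ▸ (hroots hξ ξ).2 (by simp))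
      simpa [(hmem hξ).2.2.2.1.symm] using h1

lemma mul_le_three_mul_totalDegree {n m : ℕ} (hn : 12 ≤ n) {F : MvPolynomial (Fin 3) ℂ}
    (hF0 : F ≠ 0) (hF : ∃ e, F.IsHomogeneous e)
    (h : ∀ p ∈ TriplePts n, VanishesToOrder F m p) : m * n ≤ 3 * F.totalDegree := by
  obtain ⟨e, hF⟩ := hF
  have hn0 : n ≠ 0 := by omega
  have hcard := (Complex.isPrimitiveRoot_exp n hn0).card_nthRootsFinset
  have hmem {ζ : ℂ} : ζ ∈ Polynomial.nthRootsFinset n (1 : ℂ) ↔ ζ ^ n = 1 :=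
    Polynomial.mem_nthRootsFinset (by omega) 1
  rw [hF.totalDegree hF0]
  refine hcard ▸ mul_card_le_three_mul_degree (P := TriplePts n) (fun ζ hζ => ?_)
    (fun ζ hζ => ?_) hF0 hF fun z hz => (vanishesToOrder_iff.1 (h z hz)).X_pow_dvd_taylorAt
  · rintro rfl
    simp [hmem, hn0] at hζ
  · rw [hcard]
    exact exists_triplePts_on_line hn (hmem.1 hζ)

end TriplePoints

section Product

lemma prod_ell_ne_zero (n : ℕ) : ∏ j ∈ Finset.range n, ell n j ≠ 0 := by
  refine Finset.prod_ne_zero_iff.2 fun j _ => ?_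
  obtain ⟨c, hc, h⟩ := exists_ell_eq n j
  rw [h]
  exact mul_ne_zero (by simpa using hc) (lineForm_ne_zero (Ppt_ne_zero n j))

lemma isHomogeneous_prod_ell (n : ℕ) : (∏ j ∈ Finset.range n, ell n j).IsHomogeneous n := by
  have h : ∀ j ∈ Finset.range n, (ell n j).IsHomogeneous 1 := fun j _ => by
    obtain ⟨c, _, h⟩ := exists_ell_eq n j
    exact h ▸ (isHomogeneous_lineForm _).C_mul c
  simpa using IsHomogeneous.prod _ _ (fun _ => 1) h

lemma vanishesAt_prod {σ K ι : Type*} [Field K] {p : σ → K} {s t : Finset ι} (hst : s ⊆ t)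
    {f : ι → MvPolynomial σ K} (h : ∀ i ∈ s, eval p (f i) = 0) :
    VanishesAt p s.card (∏ i ∈ t, f i) := by
  classical
  rw [← Finset.prod_sdiff hst]
  refine VanishesAt.mul_left ?_ _
  clear hst
  induction s using Finset.induction_on with
  | empty => trivial
  | insert i s hi ih =>
    simp only [Finset.forall_mem_insert] at h
    rw [Finset.prod_insert hi, Finset.card_insert_of_notMem hi]
    exact (ih h.2).mul_of_eval_eq_zero h.1

lemma vanishesToOrder_prod_ell {n : ℕ} {p : ℂ} (hp : p ∈ TriplePts n) :
    VanishesToOrder (∏ j ∈ Finset.range n, ell n j) 3 p := by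
  classical
  let s := (Finset.range n).filter fun j => p ∈ Bline n j
  have hs : 3 ≤ s.card := by
    have h : {j : ℕ | j < n ∧ p ∈ Bline n j} = s := by ext; simp [s]
    have hp' : 3 ≤ {j : ℕ | j < n ∧ p ∈ Bline n j}.ncard := hp
    rwa [h, Set.ncard_coe_finset] at hp'
  refine vanishesToOrder_iff.2 ((vanishesAt_prod (Finset.filter_subset _ _) fun j hj => ?_).mono hs)
  exact (mem_Bline_iff n j p).1 (Finset.mem_filter.1 hj).2

end Product

end Boroczky

/-- The Waldschmidt constant of the defining ideal of the triple points of the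
Böröczky configuration (`6 ∣ n`, `n ≥ 12`) equals `n/3`:
(i) any nonzero homogeneous form vanishing to order `≥ m` at every triple point
has degree at least `mn/3`; (ii) the product of the `n` defining linear forms
of the configuration lines is nonzero, homogeneous of degree `n`, and vanishes
to order `≥ 3` at every triple point; (iii) the infimum of `deg F / m` over all
`m ≥ 1` and nonzero homogeneous `F` vanishing to order `≥ m` at all triple
points equals `n/3`. -/
theorem boroczky_waldschmidt (n : ℕ) (hn : 12 ≤ n) (hdvd : 6 ∣ n) :
    (∀ m : ℕ, 1 ≤ m → ∀ F : MvPolynomial (Fin 3) ℂ, F ≠ 0 →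
      (∃ e, F.IsHomogeneous e) → (∀ p ∈ TriplePts n, VanishesToOrder F m p) →
      m * n ≤ 3 * F.totalDegree) ∧
    ((∏ j ∈ Finset.range n, ell n j) ≠ 0 ∧
      (∏ j ∈ Finset.range n, ell n j).IsHomogeneous n ∧
      (∀ p ∈ TriplePts n, VanishesToOrder (∏ j ∈ Finset.range n, ell n j) 3 p)) ∧
    sInf {r : ℝ | ∃ (m : ℕ) (F : MvPolynomial (Fin 3) ℂ), 1 ≤ m ∧ F ≠ 0 ∧
        (∃ e, F.IsHomogeneous e) ∧ (∀ p ∈ TriplePts n, VanishesToOrder F m p) ∧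
        r = (F.totalDegree : ℝ) / (m : ℝ)} = (n : ℝ) / 3 := by
  have lower : ∀ m : ℕ, 1 ≤ m → ∀ F : MvPolynomial (Fin 3) ℂ, F ≠ 0 →
      (∃ e, F.IsHomogeneous e) → (∀ p ∈ TriplePts n, VanishesToOrder F m p) →
      m * n ≤ 3 * F.totalDegree := fun _ _ _ hF0 hF h =>
    Boroczky.mul_le_three_mul_totalDegree hn hF0 hF h
  have hne := Boroczky.prod_ell_ne_zero n
  have hhom := Boroczky.isHomogeneous_prod_ell n
  have hvan : ∀ p ∈ TriplePts n, VanishesToOrder (∏ j ∈ Finset.range n, ell n j) 3 p :=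
    fun _ => Boroczky.vanishesToOrder_prod_ell
  refine ⟨lower, ⟨hne, hhom, hvan⟩, IsLeast.csInf_eq ⟨?_, ?_⟩⟩
  · refine ⟨3, _, by norm_num, hne, ⟨n, hhom⟩, hvan, ?_⟩
    rw [hhom.totalDegree hne]
    norm_num
  · rintro r ⟨m, F, hm, hF0, hF, h, rfl⟩
    have hle : (m * n : ℝ) ≤ 3 * F.totalDegree := by exact_mod_cast lower m hm F hF0 hF h
    have hm0 : (0 : ℝ) < m := by exact_mod_cast hm
    rw [div_le_div_iff₀ (by norm_num) hm0]
    linarith
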